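/- arXiv:1408.3715 — 7 statements merged into one kernel-verified Lean document; each statement's English description precedes it below -/
import Mathlib

section
/- Let (X_n)_{n≥1} be an ascending sequence of topological spaces and let X = ⋃_n X_n carry the DL-topology. If O_n ⊆ X_n is open in X_n for each n and O_1 ⊆ O_2 ⊆ ⋯, then O = ⋃_n O_n is open in X; moreover the DL-topology on O determined by the ascending sequence (O_n) (each O_n carrying the subspace topology induced from X_n) coincides with the subspace topology induced on O by X. -/
open Set Topology TopologicalSpace

theorem isOpen_iUnion_aux {X : Type*} (A : ℕ → Set X)
    (hA : Monotone A) (t : ∀ n, TopologicalSpace (A n))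
    (hcont : ∀ n, Continuous[t n, t (n + 1)] (Set.inclusion (hA (Nat.le_succ n))))
    (B : ℕ → Set X) (hB : Monotone B)
    (hopen : ∀ n, IsOpen[t n] ((Subtype.val : A n → X) ⁻¹' B n)) :
    IsOpen[⨆ n, (t n).coinduced (Subtype.val : A n → X)] (⋃ n, B n) := by
  have hc : ∀ m k, Continuous[t m, t (m + k)] (Set.inclusion (hA (Nat.le_add_right m k))) := by
    intro m k
    induction k with
    | zero => exact @continuous_id _ (t m)
    | succ k ih => exact @Continuous.comp _ _ _ (t m) (t (m + k)) (t (m + k + 1)) _ _ (hcont (m + k)) ih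
  rw [isOpen_iSup_iff]
  intro m
  rw [isOpen_coinduced]
  have : (Subtype.val : A m → X) ⁻¹' (⋃ n, B n) =
      ⋃ k, (Set.inclusion (hA (Nat.le_add_right m k))) ⁻¹'
        ((Subtype.val : A (m + k) → X) ⁻¹' B (m + k)) := by
    ext x
    simp only [mem_preimage, mem_iUnion, Set.coe_inclusion]
    constructor
    · rintro ⟨n, hn⟩
      exact ⟨n, hB (Nat.le_add_left n m) hn⟩
    · rintro ⟨k, hk⟩
      exact ⟨_, hk⟩
  rw [this]
  letI := t m
  exact isOpen_iUnion fun k => (hc m k).isOpen_preimage _ (hopen (m + k))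

/-- Proposition (Glöckner): if `(X_n)` is an ascending sequence of topological spaces with
direct limit `X` carrying the `DL`-topology, `O_n ⊆ X_n` is open in `X_n` for each `n` and
`O_1 ⊆ O_2 ⊆ ⋯`, then `O = ⋃ O_n` is open in `X`; moreover the `DL`-topology on `O`
determined by the ascending sequence `(O_n)` (each `O_n` with the subspace topology from
`X_n`) coincides with the subspace topology induced on `O` by `X`. -/
theorem isOpen_iUnion_and_DLtopology_eq_subspace {X : Type*} (A : ℕ → Set X)
    (hA : Monotone A) (hcov : ⋃ n, A n = univ)
    (t : ∀ n, TopologicalSpace (A n))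
    (hcont : ∀ n, Continuous[t n, t (n + 1)] (Set.inclusion (hA (Nat.le_succ n))))
    (B : ℕ → Set X) (hBA : ∀ n, B n ⊆ A n) (hB : Monotone B)
    (hopen : ∀ n, IsOpen[t n] ((Subtype.val : A n → X) ⁻¹' B n)) :
    IsOpen[⨆ n, (t n).coinduced (Subtype.val : A n → X)] (⋃ n, B n) ∧
      (⨆ n, TopologicalSpace.coinduced (Set.inclusion (Set.subset_iUnion B n))
          (TopologicalSpace.induced (Set.inclusion (hBA n)) (t n))) =
        TopologicalSpace.induced (Subtype.val : (⋃ n, B n : Set X) → X)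
          (⨆ n, (t n).coinduced (Subtype.val : A n → X)) := by
  refine ⟨isOpen_iUnion_aux A hA t hcont B hB hopen, ?_⟩
  apply TopologicalSpace.ext_iff.mpr
  intro W
  rw [isOpen_iSup_iff, @isOpen_induced_iff _ _ (_)]
  constructor
  · intro hW
    refine ⟨⋃ n, (Subtype.val '' W ∩ B n), ?_, ?_⟩
    · apply isOpen_iUnion_aux A hA t hcont
      · intro i j hij
        exact inter_subset_inter_right _ (hB hij)
      · intro n
        have h := hW n
        rw [isOpen_coinduced, @isOpen_induced_iff _ _ (t n)] at h
        obtain ⟨V, hV, hVW⟩ := h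
        have : (Subtype.val : A n → X) ⁻¹' (Subtype.val '' W ∩ B n) =
            V ∩ (Subtype.val : A n → X) ⁻¹' B n := by
          ext x
          simp only [mem_preimage, mem_inter_iff, and_congr_left_iff]
          intro hx
          have h2 : _ ↔ _ := Set.ext_iff.mp hVW ⟨x.1, hx⟩
          have h3 : x ∈ V ↔ (⟨x.1, subset_iUnion B n hx⟩ : (⋃ n, B n : Set X)) ∈ W := h2
          rw [h3]
          constructor
          · rintro ⟨y, hy, hyx⟩
            have : y = ⟨x.1, subset_iUnion B n hx⟩ := Subtype.ext hyx
            exact this ▸ hy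
          · intro h
            exact ⟨_, h, rfl⟩
        rw [this]
        letI := t n
        exact IsOpen.inter hV (hopen n)
    · ext x
      simp only [mem_preimage, mem_iUnion, mem_inter_iff]
      constructor
      · rintro ⟨n, ⟨y, hy, hyx⟩, -⟩
        exact Subtype.ext hyx ▸ hy
      · intro h
        obtain ⟨n, hn⟩ := mem_iUnion.mp x.2
        exact ⟨n, ⟨x, h, rfl⟩, hn⟩
  · rintro ⟨V, hV, rfl⟩ n
    rw [isOpen_iSup_iff] at hV
    have h := hV n
    rw [isOpen_coinduced] at h
    rw [isOpen_coinduced, @isOpen_induced_iff _ _ (t n)]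
    exact ⟨_, h, rfl⟩
end

section
/- Let (X_n)_{n≥1} be an ascending sequence of topological spaces and let X = ⋃_n X_n carry the DL-topology. If each X_n is a locally compact Hausdorff space, then X is Hausdorff. -/
open Set Topology TopologicalSpace

theorem aux_sep {Y : Type*} [TopologicalSpace Y] [LocallyCompactSpace Y] [T2Space Y]
    {K L : Set Y} (hK : IsCompact K) (hL : IsCompact L) (h : Disjoint K L) :
    ∃ K' L' : Set Y, IsCompact K' ∧ IsCompact L' ∧ Disjoint K' L' ∧
      K ⊆ interior K' ∧ L ⊆ interior L' := by
  obtain ⟨U, V, hU, hV, hKU, hLV, hUV⟩ := SeparatedNhds.of_isCompact_isCompact hK hL h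
  obtain ⟨K', hK', h1, h2⟩ := exists_compact_between hK hU hKU
  obtain ⟨L', hL', h3, h4⟩ := exists_compact_between hL hV hLV
  exact ⟨K', L', hK', hL', hUV.mono h2 h4, h1, h3⟩

/-- Proposition (Glöckner): the direct limit of an ascending sequence of locally compact
Hausdorff topological spaces, endowed with the `DL`-topology, is Hausdorff. -/
theorem t2Space_of_directLimit_of_locallyCompact {X : Type*} (A : ℕ → Set X)
    (hA : Monotone A) (hcov : ⋃ n, A n = univ)
    (t : ∀ n, TopologicalSpace (A n))
    (hcont : ∀ n, Continuous[t n, t (n + 1)] (Set.inclusion (hA (Nat.le_succ n))))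
    (hLC : ∀ n, @LocallyCompactSpace (A n) (t n))
    (hT2 : ∀ n, @T2Space (A n) (t n)) :
    @T2Space X (⨆ n, (t n).coinduced (Subtype.val : A n → X)) := by
  have hc : ∀ i j, (h : i ≤ j) → Continuous (Set.inclusion (hA h)) := by
    intro i j h
    induction j, h using Nat.le_induction with
    | base => exact continuous_id
    | succ j h ih => exact (hcont j).comp ih
  have key : ∀ (n0 : ℕ) (S : ∀ m, Set (A (n0 + m))),
      (∀ m, Set.inclusion (hA (Nat.le_succ (n0 + m))) '' S m ⊆ interior (S (m + 1))) →
      IsOpen[⨆ n, (t n).coinduced (Subtype.val : A n → X)]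
        (⋃ m, (Subtype.val '' S m : Set X)) := by
    intro n0 S hS
    rw [isOpen_iSup_iff]
    intro j
    rw [isOpen_coinduced, isOpen_iff_mem_nhds]
    have hmono : Monotone (fun m => (Subtype.val '' S m : Set X)) := by
      apply monotone_nat_of_le_succ
      rintro m _ ⟨z, hz, rfl⟩
      exact ⟨_, interior_subset (hS m ⟨z, hz, rfl⟩), rfl⟩
    rintro z hz
    obtain ⟨m, hm⟩ := mem_iUnion.1 hz
    obtain ⟨w, hw, hwz⟩ := hmono (Nat.le_add_right m j) hm
    have hle : j ≤ n0 + (m + j + 1) := by omega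
    have hmem : Set.inclusion (hA hle) z ∈ interior (S (m + j + 1)) := by
      have := hS (m + j) ⟨w, hw, rfl⟩
      have e : Set.inclusion (hA hle) z =
          Set.inclusion (hA (Nat.le_succ (n0 + (m + j)))) w := Subtype.ext hwz.symm
      exact e ▸ this
    have := (hc j _ hle).continuousAt.preimage_mem_nhds (isOpen_interior.mem_nhds hmem)
    filter_upwards [this] with y hy
    exact mem_iUnion.2 ⟨m + j + 1, _, interior_subset hy, rfl⟩
  refine @T2Space.mk X (_) ?_
  intro x y hxy
  obtain ⟨a, ha⟩ := mem_iUnion.1 (hcov ▸ mem_univ x : x ∈ ⋃ n, A n)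
  obtain ⟨b, hb⟩ := mem_iUnion.1 (hcov ▸ mem_univ y : y ∈ ⋃ n, A n)
  have hx : x ∈ A (a + b) := hA (Nat.le_add_right a b) ha
  have hy : y ∈ A (a + b) := hA (Nat.le_add_left b a) hb
  generalize a + b = n0 at hx hy
  let P : ℕ → Type _ := fun m => {p : Set (A (n0 + m)) × Set (A (n0 + m)) //
    IsCompact p.1 ∧ IsCompact p.2 ∧ Disjoint p.1 p.2}
  have step : ∀ m (p : P m), ∃ q : P (m + 1),
      Set.inclusion (hA (Nat.le_succ (n0 + m))) '' p.1.1 ⊆ interior q.1.1 ∧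
      Set.inclusion (hA (Nat.le_succ (n0 + m))) '' p.1.2 ⊆ interior q.1.2 := by
    rintro m ⟨⟨K, L⟩, hK, hL, hd⟩
    obtain ⟨K', L', h1, h2, h3, h4, h5⟩ := @aux_sep _ (t (n0 + m + 1)) (hLC _) (hT2 _) _ _
      (hK.image (hcont (n0 + m))) (hL.image (hcont (n0 + m)))
      ((disjoint_image_iff (Set.inclusion_injective _)).2 hd)
    exact ⟨⟨(K', L'), h1, h2, h3⟩, h4, h5⟩
  choose f hf using step
  let p0 : P 0 := ⟨({⟨x, hx⟩}, {⟨y, hy⟩}), isCompact_singleton, isCompact_singleton, by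
    simpa using hxy⟩
  let F : ∀ m, P m := fun m => Nat.rec p0 f m
  refine ⟨_, _, key n0 (fun m => (F m).1.1) (fun m => (hf m (F m)).1),
    key n0 (fun m => (F m).1.2) (fun m => (hf m (F m)).2),
    mem_iUnion.2 ⟨0, ⟨x, hx⟩, rfl, rfl⟩, mem_iUnion.2 ⟨0, ⟨y, hy⟩, rfl, rfl⟩, ?_⟩
  have m1 : Monotone (fun m => (Subtype.val '' (F m).1.1 : Set X)) := by
    apply monotone_nat_of_le_succ
    rintro m _ ⟨z, hz, rfl⟩
    exact ⟨_, interior_subset ((hf m (F m)).1 ⟨z, hz, rfl⟩), rfl⟩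
  have m2 : Monotone (fun m => (Subtype.val '' (F m).1.2 : Set X)) := by
    apply monotone_nat_of_le_succ
    rintro m _ ⟨z, hz, rfl⟩
    exact ⟨_, interior_subset ((hf m (F m)).2 ⟨z, hz, rfl⟩), rfl⟩
  rw [Set.disjoint_left]
  intro z hz1 hz2
  obtain ⟨i, hi⟩ := mem_iUnion.1 hz1
  obtain ⟨j, hj⟩ := mem_iUnion.1 hz2
  have h1 := m1 (Nat.le_add_right i j) hi
  have h2 := m2 (Nat.le_add_left j i) hj
  exact Set.disjoint_left.1
    ((disjoint_image_iff Subtype.val_injective).2 (F (i + j)).2.2.2) h1 h2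
end

section
/- Let (X_n)_{n≥1} be an ascending sequence of topological spaces and let X = ⋃_n X_n carry the DL-topology. If each X_n is a T1 space and K ⊆ X is compact for the DL-topology, then K ⊆ X_n for some n. -/
open Set Topology TopologicalSpace

/-- Proposition (Glöckner): if `(X_n)` is an ascending sequence of `T1` topological spaces
and `K` is a compact subset of the direct limit `X = ⋃ X_n` for the `DL`-topology, then
`K ⊆ X_n` for some `n`. -/
theorem compact_subset_of_directLimit {X : Type*} (A : ℕ → Set X)
    (hA : Monotone A) (hcov : ⋃ n, A n = univ)
    (t : ∀ n, TopologicalSpace (A n))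
    (hcont : ∀ n, Continuous[t n, t (n + 1)] (Set.inclusion (hA (Nat.le_succ n))))
    (hT1 : ∀ n, @T1Space (A n) (t n))
    (K : Set X)
    (hK : @IsCompact X (⨆ n, (t n).coinduced (Subtype.val : A n → X)) K) :
    ∃ n, K ⊆ A n := by
  by_contra hne
  push Not at hne
  have hne' : ∀ n, ∃ x, x ∈ K ∧ x ∉ A n := fun n => Set.not_subset.mp (hne n)
  choose x hxK hxA using hne'
  letI τ : TopologicalSpace X := ⨆ n, (t n).coinduced (Subtype.val : A n → X)
  have hopen : ∀ m, IsOpen ((x '' Set.Ici m)ᶜ) := by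
    intro m
    refine isOpen_iSup_iff.mpr fun n => ?_
    rw [isOpen_coinduced, Set.preimage_compl]
    letI := t n
    haveI := hT1 n
    rw [isOpen_compl_iff]
    apply Set.Finite.isClosed
    have hfin : (x '' Set.Iio n).Finite := (Set.finite_Iio n).image x
    refine (hfin.preimage (f := (Subtype.val : A n → X))
      Subtype.val_injective.injOn).subset ?_
    rintro y ⟨k, -, hk⟩
    refine ⟨k, ?_, hk⟩
    by_contra hkn
    have hnk : n ≤ k := not_lt.mp hkn
    exact hxA k (hA hnk (hk ▸ y.2))
  obtain ⟨m, hm⟩ := IsCompact.elim_directed_cover (X := X) hK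
    (fun m => (x '' Set.Ici m)ᶜ) hopen
    (by
      intro y _
      have hy : y ∈ ⋃ n, A n := hcov ▸ Set.mem_univ y
      obtain ⟨n, hn⟩ := Set.mem_iUnion.mp hy
      refine Set.mem_iUnion.mpr ⟨n, ?_⟩
      rintro ⟨k, hk, rfl⟩
      exact hxA k (hA hk hn))
    (Monotone.directed_le fun a b hab =>
      Set.compl_subset_compl.mpr (Set.image_mono (Set.Ici_subset_Ici.mpr hab)))
  exact hm (hxK m) ⟨m, Set.self_mem_Ici, rfl⟩
end

section
/- Let (X_n)_{n≥1} be a strict ascending sequence of topological spaces such that, for each n, X_n is a closed subset of X_{n+1}, and let X = ⋃_n X_n carry the DL-topology. If each X_n is a normal topological space, then X is normal; if in addition each X_n is T1, then X is Hausdorff. -/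
open Set Topology TopologicalSpace

/-- Normal separation with disjoint closures. -/
theorem sep_closures {Y : Type*} [TopologicalSpace Y] [NormalSpace Y] {E F : Set Y}
    (hE : IsClosed E) (hF : IsClosed F) (h : Disjoint E F) :
    ∃ U V : Set Y, IsOpen U ∧ IsOpen V ∧ E ⊆ U ∧ F ⊆ V ∧ Disjoint (closure U) (closure V) := by
  obtain ⟨U, hU, hEU, hUF⟩ := normal_exists_closure_subset hE hF.isOpen_compl
    (subset_compl_iff_disjoint_right.2 h)
  obtain ⟨V, hV, hFV, hVU⟩ := normal_exists_closure_subset hF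
    (isClosed_closure (s := U)).isOpen_compl (fun x hx hx' => hUF hx' hx)
  exact ⟨U, V, hU, hV, hEU, hFV, (subset_compl_iff_disjoint_right.1 hVU).symm⟩

theorem normal_aux {X : Type*} (A : ℕ → Set X)
    (hA : Monotone A) (hcov : ⋃ n, A n = univ)
    [t : ∀ n, TopologicalSpace (A n)]
    (hemb : ∀ n, IsEmbedding (Set.inclusion (hA (Nat.le_succ n))))
    (hclosed : ∀ n, IsClosed ((Subtype.val : A (n + 1) → X) ⁻¹' A n))
    [hnormal : ∀ n, NormalSpace (A n)] (C D : Set X) (hCD : Disjoint C D)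
    (hC : ∀ n, IsClosed ((Subtype.val : A n → X) ⁻¹' C))
    (hD : ∀ n, IsClosed ((Subtype.val : A n → X) ⁻¹' D)) :
    ∃ U V : Set X, (∀ n, IsOpen ((Subtype.val : A n → X) ⁻¹' U)) ∧
      (∀ n, IsOpen ((Subtype.val : A n → X) ⁻¹' V)) ∧ C ⊆ U ∧ D ⊆ V ∧ Disjoint U V := by
  have hce : ∀ n, IsClosedEmbedding (Set.inclusion (hA (Nat.le_succ n))) := fun n =>
    ⟨hemb n, by
      rw [Set.range_inclusion]
      exact hclosed n⟩
  let Good : ∀ n, Set (A n) × Set (A n) → Prop := fun n p =>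
    IsOpen p.1 ∧ IsOpen p.2 ∧ Subtype.val ⁻¹' C ⊆ p.1 ∧ Subtype.val ⁻¹' D ⊆ p.2 ∧
      Disjoint (closure p.1) (closure p.2)
  have h0 : ∃ p, Good 0 p := by
    obtain ⟨U, V, h⟩ := sep_closures (hC 0) (hD 0) (hCD.preimage _)
    exact ⟨(U, V), h⟩
  have hs : ∀ n p, Good n p → ∃ q, Good (n + 1) q ∧
      Set.inclusion (hA (Nat.le_succ n)) '' p.1 ⊆ q.1 ∧
      Set.inclusion (hA (Nat.le_succ n)) '' p.2 ⊆ q.2 := by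
    rintro n ⟨U, V⟩ ⟨hU, hV, hCU, hDV, hdis⟩
    dsimp only at *
    obtain ⟨U', V', h1, h2, h3, h4, h5⟩ := sep_closures
      (((hce n).isClosedMap _ (isClosed_closure (s := U))).union (hC (n + 1)))
      (((hce n).isClosedMap _ (isClosed_closure (s := V))).union (hD (n + 1))) (by
        rw [Set.disjoint_left] at *
        rintro x (⟨y, hy, rfl⟩ | hx) (⟨z, hz, hyz⟩ | hx')
        · exact hdis hy ((hemb n).injective hyz ▸ hz)
        · exact hdis hy (subset_closure (hDV hx'))
        · subst hyz
          exact hdis (subset_closure (hCU hx)) hz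
        · exact hCD hx hx')
    refine ⟨(U', V'), ⟨h1, h2, subset_union_right.trans h3, subset_union_right.trans h4, h5⟩,
      ?_, ?_⟩
    · exact (image_mono subset_closure).trans (subset_union_left.trans h3)
    · exact (image_mono subset_closure).trans (subset_union_left.trans h4)
  choose p0 hp0 using h0
  choose f hf hf1 hf2 using hs
  let s : ∀ n, {p // Good n p} := fun n =>
    Nat.rec ⟨p0, hp0⟩ (fun n p => ⟨f n p.1 p.2, hf n p.1 p.2⟩) n
  have m1 : Monotone (fun n => (Subtype.val '' (s n).1.1 : Set X)) := by
    refine monotone_nat_of_le_succ fun n => ?_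
    rintro _ ⟨x, hx, rfl⟩
    exact ⟨_, hf1 n (s n).1 (s n).2 ⟨x, hx, rfl⟩, rfl⟩
  have m2 : Monotone (fun n => (Subtype.val '' (s n).1.2 : Set X)) := by
    refine monotone_nat_of_le_succ fun n => ?_
    rintro _ ⟨x, hx, rfl⟩
    exact ⟨_, hf2 n (s n).1 (s n).2 ⟨x, hx, rfl⟩, rfl⟩
  have hcont : ∀ n m (h : n ≤ m), Continuous (Set.inclusion (hA h)) := by
    intro n m h
    induction m, h using Nat.le_induction with
    | base => exact continuous_id
    | succ m h ih => exact (hemb m).continuous.comp ih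
  have hop : ∀ W : ∀ n, Set (A n), (∀ n, IsOpen (W n)) →
      Monotone (fun n => (Subtype.val '' W n : Set X)) →
      ∀ n, IsOpen ((Subtype.val : A n → X) ⁻¹' (⋃ m, Subtype.val '' W m)) := by
    intro W hW hm n
    have : (Subtype.val : A n → X) ⁻¹' (⋃ m, Subtype.val '' W m) =
        ⋃ m, ⋃ h : n ≤ m, Set.inclusion (hA h) ⁻¹' W m := by
      ext x
      simp only [mem_preimage, mem_iUnion]
      constructor
      · rintro ⟨m, hx⟩
        obtain ⟨y, hy, hyx⟩ := hm (le_max_right n m) hx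
        refine ⟨max n m, le_max_left _ _, ?_⟩
        have : Set.inclusion (hA (le_max_left n m)) x = y := Subtype.ext hyx.symm
        rw [this]
        exact hy
      · rintro ⟨m, h, hx⟩
        exact ⟨m, _, hx, rfl⟩
    rw [this]
    exact isOpen_iUnion fun m => isOpen_iUnion fun h => (hW m).preimage (hcont n m h)
  refine ⟨⋃ m, Subtype.val '' (s m).1.1, ⋃ m, Subtype.val '' (s m).1.2,
    hop _ (fun n => (s n).2.1) m1, hop _ (fun n => (s n).2.2.1) m2, ?_, ?_, ?_⟩
  · intro x hx
    obtain ⟨n, hn⟩ := mem_iUnion.1 (hcov ▸ mem_univ x : x ∈ ⋃ n, A n)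
    exact mem_iUnion.2 ⟨n, ⟨x, hn⟩, (s n).2.2.2.1 hx, rfl⟩
  · intro x hx
    obtain ⟨n, hn⟩ := mem_iUnion.1 (hcov ▸ mem_univ x : x ∈ ⋃ n, A n)
    exact mem_iUnion.2 ⟨n, ⟨x, hn⟩, (s n).2.2.2.2.1 hx, rfl⟩
  · rw [Set.disjoint_left]
    intro x hx hx'
    obtain ⟨n, hn⟩ := mem_iUnion.1 hx
    obtain ⟨m, hm⟩ := mem_iUnion.1 hx'
    obtain ⟨y, hy, hyx⟩ := m1 (le_max_left n m) hn
    obtain ⟨z, hz, hzx⟩ := m2 (le_max_right n m) hm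
    have : y = z := Subtype.ext (hyx.trans hzx.symm)
    subst this
    exact Set.disjoint_left.1 (s (max n m)).2.2.2.2.2 (subset_closure hy) (subset_closure hz)

/-- Proposition: let `(X_n)` be a strict ascending sequence of topological spaces (each
inclusion `X_n ↪ X_{n+1}` is a topological embedding) such that `X_n` is closed in
`X_{n+1}`, and let `X = ⋃ X_n` carry the `DL`-topology. If each `X_n` is normal then `X`
is normal; if in addition each `X_n` is `T1`, then `X` is Hausdorff. -/
theorem normalSpace_of_strict_directLimit_closed {X : Type*} (A : ℕ → Set X)
    (hA : Monotone A) (hcov : ⋃ n, A n = univ)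
    (t : ∀ n, TopologicalSpace (A n))
    (hemb : ∀ n, @IsEmbedding (A n) (A (n + 1)) (t n) (t (n + 1))
      (Set.inclusion (hA (Nat.le_succ n))))
    (hclosed : ∀ n, IsClosed[t (n + 1)] ((Subtype.val : A (n + 1) → X) ⁻¹' A n))
    (hnormal : ∀ n, @NormalSpace (A n) (t n)) :
    @NormalSpace X (⨆ n, (t n).coinduced (Subtype.val : A n → X)) ∧
      ((∀ n, @T1Space (A n) (t n)) →
        @T2Space X (⨆ n, (t n).coinduced (Subtype.val : A n → X))) := by
  have hopen : ∀ S : Set X, IsOpen[⨆ n, (t n).coinduced (Subtype.val : A n → X)] S ↔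
      ∀ n, IsOpen[t n] ((Subtype.val : A n → X) ⁻¹' S) := by
    intro S
    rw [isOpen_iSup_iff]
    rfl
  have hcl : ∀ S : Set X, IsClosed[⨆ n, (t n).coinduced (Subtype.val : A n → X)] S ↔
      ∀ n, IsClosed[t n] ((Subtype.val : A n → X) ⁻¹' S) := by
    intro S
    rw [isClosed_iSup_iff]
    simp only [isClosed_coinduced]
  have hN : @NormalSpace X (⨆ n, (t n).coinduced (Subtype.val : A n → X)) := by
    refine @NormalSpace.mk X (_) ?_
    intro C D hC hD hCD
    obtain ⟨U, V, hU, hV, h⟩ := normal_aux A hA hcov hemb hclosed C D hCD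
      ((hcl C).1 hC) ((hcl D).1 hD)
    exact ⟨U, V, (hopen U).2 hU, (hopen V).2 hV, h⟩
  refine ⟨hN, fun h1 => ?_⟩
  have hT1 : @T1Space X (⨆ n, (t n).coinduced (Subtype.val : A n → X)) := by
    refine @T1Space.mk X (_) ?_
    intro x
    rw [hcl]
    intro n
    exact (Set.subsingleton_singleton.preimage Subtype.val_injective).isClosed
  letI : TopologicalSpace X := ⨆ n, (t n).coinduced (Subtype.val : A n → X)
  haveI : T4Space X := @T4Space.mk X _ hT1 hN
  exact inferInstanceAs (T2Space X)
end

section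
/- Let (X_n)_{n≥1} be a strict ascending sequence of topological spaces such that, for each n, X_n is a closed subset of X_{n+1}, and let X = ⋃_n X_n carry the DL-topology. If each X_n is Hausdorff and paracompact, then X is normal and Hausdorff. -/
open Set Topology TopologicalSpace

theorem aux_sep_s5 {Y : Type*} [TopologicalSpace Y] [NormalSpace Y] {K L : Set Y}
    (hK : IsClosed K) (hL : IsClosed L) (h : Disjoint K L) :
    ∃ p : Set Y × Set Y, IsOpen p.1 ∧ IsOpen p.2 ∧ K ⊆ p.1 ∧ L ⊆ p.2 ∧
      Disjoint (closure p.1) (closure p.2) := by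
  obtain ⟨U, hU, hKU, hUL⟩ := normal_exists_closure_subset hK hL.isOpen_compl
    (Set.subset_compl_iff_disjoint_right.2 h)
  obtain ⟨V, hV, hLV, hVU⟩ := normal_exists_closure_subset hL isClosed_closure.isOpen_compl
    (Set.subset_compl_comm.1 hUL)
  exact ⟨(U, V), hU, hV, hKU, hLV, (Set.subset_compl_iff_disjoint_right.1 hVU).symm⟩

theorem aux_open {X : Type*} (A : ℕ → Set X) (hA : Monotone A)
    (t : ∀ n, TopologicalSpace (A n))
    (hcont : ∀ n, Continuous (Set.inclusion (hA (Nat.le_succ n))))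
    (U : ∀ n, Set (A n)) (hU : ∀ n, IsOpen (U n))
    (hs : ∀ n, ∀ x ∈ U n, Set.inclusion (hA (Nat.le_succ n)) x ∈ U (n + 1)) :
    IsOpen[⨆ n, (t n).coinduced (Subtype.val : A n → X)] {x | ∃ n, ∃ h : x ∈ A n, ⟨x, h⟩ ∈ U n} := by
  have hc : ∀ m n (h : m ≤ n), Continuous (Set.inclusion (hA h)) := by
    intro m n h
    induction n, h using Nat.le_induction with
    | base => exact continuous_id
    | succ n h ih => exact (hcont n).comp ih
  have hs' : ∀ m n (h : m ≤ n), ∀ x ∈ U m, Set.inclusion (hA h) x ∈ U n := by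
    intro m n h x hx
    induction n, h using Nat.le_induction with
    | base => exact hx
    | succ n h ih => exact hs n _ ih
  rw [isOpen_iSup_iff]
  intro m
  rw [isOpen_coinduced]
  have : (Subtype.val : A m → X) ⁻¹' {x | ∃ n, ∃ h : x ∈ A n, ⟨x, h⟩ ∈ U n} =
      ⋃ n, ⋃ h : m ≤ n, Set.inclusion (hA h) ⁻¹' U n := by
    ext x
    simp only [mem_preimage, mem_setOf_eq, mem_iUnion]
    constructor
    · rintro ⟨n, h, hx⟩
      exact ⟨max m n, le_max_left _ _, hs' n _ (le_max_right _ _) _ hx⟩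
    · rintro ⟨n, h, hx⟩
      exact ⟨n, hA h x.2, hx⟩
  rw [this]
  exact isOpen_iUnion fun n => isOpen_iUnion fun h => (hU n).preimage (hc m n h)

/-- Proposition: let `(X_n)` be a strict ascending sequence of topological spaces (each
inclusion `X_n ↪ X_{n+1}` is a topological embedding) such that `X_n` is closed in
`X_{n+1}`, and let `X = ⋃ X_n` carry the `DL`-topology. If each `X_n` is Hausdorff and
paracompact, then `X` is normal and Hausdorff. -/
theorem normal_t2_of_strict_directLimit_paracompact {X : Type*} (A : ℕ → Set X)
    (hA : Monotone A) (hcov : ⋃ n, A n = univ)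
    (t : ∀ n, TopologicalSpace (A n))
    (hemb : ∀ n, @IsEmbedding (A n) (A (n + 1)) (t n) (t (n + 1))
      (Set.inclusion (hA (Nat.le_succ n))))
    (hclosed : ∀ n, IsClosed[t (n + 1)] ((Subtype.val : A (n + 1) → X) ⁻¹' A n))
    (hT2 : ∀ n, @T2Space (A n) (t n))
    (hpara : ∀ n, @ParacompactSpace (A n) (t n)) :
    @NormalSpace X (⨆ n, (t n).coinduced (Subtype.val : A n → X)) ∧
      @T2Space X (⨆ n, (t n).coinduced (Subtype.val : A n → X)) := by
  have hn : ∀ n, NormalSpace (A n) := fun n => by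
    have := hT2 n; have := hpara n; infer_instance
  have hcl : ∀ n, IsClosedEmbedding (Set.inclusion (hA (Nat.le_succ n))) := fun n =>
    ⟨hemb n, by rw [Set.range_inclusion]; exact hclosed n⟩
  have hclosedX : ∀ C : Set X, IsClosed[⨆ n, (t n).coinduced (Subtype.val : A n → X)] C ↔
      ∀ n, IsClosed ((Subtype.val : A n → X) ⁻¹' C) := by
    intro C
    rw [isClosed_iSup_iff]
    exact forall_congr' fun n => isClosed_coinduced
  have hN : @NormalSpace X (⨆ n, (t n).coinduced (Subtype.val : A n → X)) := by
    refine @NormalSpace.mk X (_) ?_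
    intro C D hC hD hCD
    rw [hclosedX] at hC hD
    let P : ∀ n, Set (A n) × Set (A n) → Prop := fun n p =>
      IsOpen p.1 ∧ IsOpen p.2 ∧ Subtype.val ⁻¹' C ⊆ p.1 ∧ Subtype.val ⁻¹' D ⊆ p.2 ∧
      Disjoint (closure p.1) (closure p.2)
    have h0 : ∃ p, P 0 p := aux_sep_s5 (hC 0) (hD 0) (hCD.preimage _)
    have hstep : ∀ n (p : {p // P n p}), ∃ q : {q // P (n + 1) q},
        (∀ x ∈ p.1.1, Set.inclusion (hA (Nat.le_succ n)) x ∈ q.1.1) ∧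
        (∀ x ∈ p.1.2, Set.inclusion (hA (Nat.le_succ n)) x ∈ q.1.2) := by
      rintro n ⟨⟨U, V⟩, hU, hV, hCU, hDV, hUV⟩
      obtain ⟨q, h1, h2, h3, h4, h5⟩ := aux_sep_s5
        (K := Subtype.val ⁻¹' C ∪ Set.inclusion (hA (Nat.le_succ n)) '' closure U)
        (L := Subtype.val ⁻¹' D ∪ Set.inclusion (hA (Nat.le_succ n)) '' closure V)
        ((hC _).union ((hcl n).isClosedMap _ isClosed_closure))
        ((hD _).union ((hcl n).isClosedMap _ isClosed_closure)) (by
          rw [Set.disjoint_left]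
          rintro x (hx | ⟨y, hy, rfl⟩) (hx' | ⟨z, hz, hzx⟩)
          · exact Set.disjoint_left.1 hCD hx hx'
          · subst hzx
            exact Set.disjoint_left.1 hUV (subset_closure (hCU hx)) hz
          · exact Set.disjoint_left.1 hUV hy (subset_closure (hDV hx'))
          · obtain rfl := (hcl n).injective hzx
            exact Set.disjoint_left.1 hUV hy hz)
      exact ⟨⟨q, h1, h2, subset_union_left.trans h3, subset_union_left.trans h4, h5⟩,
        fun x hx => h3 (Or.inr ⟨x, subset_closure hx, rfl⟩),
        fun x hx => h4 (Or.inr ⟨x, subset_closure hx, rfl⟩)⟩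
    choose f hf1 hf2 using hstep
    obtain ⟨p0, hp0⟩ := h0
    let g : ∀ n, {p // P n p} := fun n => Nat.rec ⟨p0, hp0⟩ (fun n p => f n p) n
    have g1 : ∀ n, ∀ x ∈ (g n).1.1, Set.inclusion (hA (Nat.le_succ n)) x ∈ (g (n + 1)).1.1 :=
      fun n => hf1 n (g n)
    have g2 : ∀ n, ∀ x ∈ (g n).1.2, Set.inclusion (hA (Nat.le_succ n)) x ∈ (g (n + 1)).1.2 :=
      fun n => hf2 n (g n)
    have mono1 : ∀ m n (h : m ≤ n), ∀ x ∈ (g m).1.1, Set.inclusion (hA h) x ∈ (g n).1.1 := by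
      intro m n h x hx
      induction n, h using Nat.le_induction with
      | base => exact hx
      | succ n h ih => exact g1 n _ ih
    have mono2 : ∀ m n (h : m ≤ n), ∀ x ∈ (g m).1.2, Set.inclusion (hA h) x ∈ (g n).1.2 := by
      intro m n h x hx
      induction n, h using Nat.le_induction with
      | base => exact hx
      | succ n h ih => exact g2 n _ ih
    refine ⟨_, _, aux_open A hA t (fun n => (hcl n).continuous) (fun n => (g n).1.1)
      (fun n => (g n).2.1) g1, aux_open A hA t (fun n => (hcl n).continuous) (fun n => (g n).1.2)
      (fun n => (g n).2.2.1) g2, ?_, ?_, ?_⟩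
    · intro x hx
      obtain ⟨n, hxn⟩ := mem_iUnion.1 (hcov.symm ▸ mem_univ x : x ∈ ⋃ n, A n)
      exact ⟨n, hxn, (g n).2.2.2.1 hx⟩
    · intro x hx
      obtain ⟨n, hxn⟩ := mem_iUnion.1 (hcov.symm ▸ mem_univ x : x ∈ ⋃ n, A n)
      exact ⟨n, hxn, (g n).2.2.2.2.1 hx⟩
    · rw [Set.disjoint_left]
      rintro x ⟨m, hm, hxm⟩ ⟨n, hn', hxn⟩
      exact Set.disjoint_left.1 (g (max m n)).2.2.2.2.2
        (subset_closure (mono1 m _ (le_max_left _ _) _ hxm))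
        (subset_closure (mono2 n _ (le_max_right _ _) _ hxn))
  refine ⟨hN, ?_⟩
  have hT1 : @T1Space X (⨆ n, (t n).coinduced (Subtype.val : A n → X)) := by
    refine @T1Space.mk X (_) ?_
    intro x
    rw [hclosedX]
    intro n
    have := hT2 n
    exact ((Set.subsingleton_singleton).preimage Subtype.val_injective).isClosed
  letI : TopologicalSpace X := ⨆ n, (t n).coinduced (Subtype.val : A n → X)
  haveI : T4Space X := { hT1, hN with }
  infer_instance
end

section
/- Let (X_n)_{n≥1} be a strict ascending sequence of topological spaces such that, for each n, X_n is an open subset of X_{n+1}, and let X = ⋃_n X_n carry the DL-topology. If each X_n is Hausdorff, then X is Hausdorff. -/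
open Set Topology TopologicalSpace

/-- Proposition: let `(X_n)` be a strict ascending sequence of topological spaces (each
inclusion `X_n ↪ X_{n+1}` is a topological embedding) such that `X_n` is open in
`X_{n+1}`, and let `X = ⋃ X_n` carry the `DL`-topology. If each `X_n` is Hausdorff,
then `X` is Hausdorff. -/
theorem t2Space_of_strict_directLimit_open {X : Type*} (A : ℕ → Set X)
    (hA : Monotone A) (hcov : ⋃ n, A n = univ)
    (t : ∀ n, TopologicalSpace (A n))
    (hemb : ∀ n, @IsEmbedding (A n) (A (n + 1)) (t n) (t (n + 1))
      (Set.inclusion (hA (Nat.le_succ n))))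
    (hopen : ∀ n, IsOpen[t (n + 1)] ((Subtype.val : A (n + 1) → X) ⁻¹' A n))
    (hT2 : ∀ n, @T2Space (A n) (t n)) :
    @T2Space X (⨆ n, (t n).coinduced (Subtype.val : A n → X)) := by
  have hoe : ∀ n, IsOpenEmbedding (Set.inclusion (hA (Nat.le_succ n))) := fun n =>
    ⟨hemb n, by rw [Set.range_inclusion]; exact hopen n⟩
  have key : ∀ n m (h : n ≤ m), IsOpenEmbedding (Set.inclusion (hA h)) := by
    intro n m h
    induction m, h using Nat.le_induction with
    | base => exact IsOpenEmbedding.id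
    | succ m h ih => exact (hoe m).comp ih
  have hX : ∀ n (U : Set (A n)), IsOpen U →
      IsOpen[⨆ n, (t n).coinduced (Subtype.val : A n → X)] (Subtype.val '' U) := by
    intro n U hU
    rw [isOpen_iSup_iff]
    intro m
    rw [isOpen_coinduced]
    rcases le_total n m with h | h
    · convert (key n m h).isOpenMap U hU using 1
      ext x
      constructor
      · rintro ⟨y, hy, hxy⟩
        exact ⟨y, hy, Subtype.ext hxy⟩
      · rintro ⟨y, hy, rfl⟩
        exact ⟨y, hy, rfl⟩
    · convert hU.preimage (key m n h).continuous using 1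
      ext x
      constructor
      · rintro ⟨y, hy, hxy⟩
        have : Set.inclusion (hA h) x = y := Subtype.ext hxy.symm
        rw [Set.mem_preimage, this]
        exact hy
      · intro hx
        exact ⟨_, hx, rfl⟩
  refine @T2Space.mk X (⨆ n, (t n).coinduced (Subtype.val : A n → X)) ?_
  intro x y hxy
  obtain ⟨i, hi⟩ := Set.mem_iUnion.1 (hcov.symm ▸ Set.mem_univ x : x ∈ ⋃ n, A n)
  obtain ⟨j, hj⟩ := Set.mem_iUnion.1 (hcov.symm ▸ Set.mem_univ y : y ∈ ⋃ n, A n)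
  have hx := hA (le_max_left i j) hi
  have hy := hA (le_max_right i j) hj
  have hne : (⟨x, hx⟩ : A (max i j)) ≠ ⟨y, hy⟩ := fun h => hxy (congrArg Subtype.val h)
  obtain ⟨U, V, hU, hV, hxU, hyV, hd⟩ := (hT2 (max i j)).t2 hne
  exact ⟨_, _, hX _ U hU, hX _ V hV, ⟨_, hxU, rfl⟩, ⟨_, hyV, rfl⟩,
    (Set.disjoint_image_iff Subtype.val_injective).2 hd⟩
end

section
/- Let (X_n)_{n≥1} be a strict ascending sequence of topological spaces and let X = ⋃_n X_n carry the DL-topology. Then for every n the inclusion X_n ↪ X is a topological embedding, i.e. the DL-topology on X induces on X_n its original topology. -/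
open Set Topology TopologicalSpace

/-- For a strict ascending sequence `(X_n)` of topological spaces (each inclusion
`X_n ↪ X_{n+1}` is a topological embedding) with direct limit `X = ⋃ X_n` carrying the
`DL`-topology, every inclusion `X_n ↪ X` is a topological embedding; i.e. the
`DL`-topology on `X` induces on each `X_n` its original topology. -/
theorem isEmbedding_inclusion_directLimit {X : Type*} (A : ℕ → Set X)
    (hA : Monotone A) (hcov : ⋃ n, A n = univ)
    (t : ∀ n, TopologicalSpace (A n))
    (hemb : ∀ n, @IsEmbedding (A n) (A (n + 1)) (t n) (t (n + 1))
      (Set.inclusion (hA (Nat.le_succ n)))) :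
    ∀ n, @IsEmbedding (A n) X (t n)
      (⨆ m, (t m).coinduced (Subtype.val : A m → X)) (Subtype.val : A n → X) := by
  intro n
  have step : ∀ m (S : Set X), IsOpen[t m] ((Subtype.val : A m → X) ⁻¹' S) →
      ∃ S' : Set X, IsOpen[t (m+1)] ((Subtype.val : A (m+1) → X) ⁻¹' S') ∧
        ∀ x ∈ A m, (x ∈ S' ↔ x ∈ S) := by
    intro m S hS
    have h := (hemb m).eq_induced
    rw [h] at hS
    obtain ⟨O, hO, hOS⟩ := hS
    refine ⟨Subtype.val '' O, ?_, ?_⟩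
    · rw [Set.preimage_image_eq _ Subtype.val_injective]; exact hO
    · intro x hx
      have := Set.ext_iff.1 hOS ⟨x, hx⟩
      simp only [Set.mem_preimage] at this
      rw [← this]
      constructor
      · rintro ⟨y, hy, rfl⟩
        exact hy
      · intro hy
        exact ⟨_, hy, rfl⟩
  have down : ∀ (V : Set X) m, IsOpen[t (m+1)] ((Subtype.val : A (m+1) → X) ⁻¹' V) →
      IsOpen[t m] ((Subtype.val : A m → X) ⁻¹' V) := by
    intro V m hV
    rw [(hemb m).eq_induced]
    exact ⟨_, hV, rfl⟩
  have down' : ∀ (V : Set X) k m, IsOpen[t (m+k)] ((Subtype.val : A (m+k) → X) ⁻¹' V) →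
      IsOpen[t m] ((Subtype.val : A m → X) ⁻¹' V) := by
    intro V k
    induction k with
    | zero => intro m h; exact h
    | succ k ih => intro m h; exact ih m (down V (m+k) h)
  choose g hg1 hg2 using step
  refine @IsEmbedding.mk _ _ (t n) (_) _ (@IsInducing.mk _ _ (t n) (_) _ ?_)
    Subtype.val_injective
  apply le_antisymm
  · rw [← continuous_iff_le_induced, continuous_iff_coinduced_le]
    exact le_iSup (fun m => (t m).coinduced (Subtype.val : A m → X)) n
  · intro U hU
    let W : ∀ k, {S : Set X // IsOpen[t (n+k)] ((Subtype.val : A (n+k) → X) ⁻¹' S)} :=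
      fun k => Nat.rec ⟨Subtype.val '' U, by
        change IsOpen[t n] ((Subtype.val : A n → X) ⁻¹' (Subtype.val '' U))
        rw [Set.preimage_image_eq _ Subtype.val_injective]; exact hU⟩
        (fun k S => ⟨g (n+k) S.1 S.2, hg1 (n+k) S.1 S.2⟩) k
    have hW : ∀ k, ∀ x ∈ A (n+k), (x ∈ (W (k+1)).1 ↔ x ∈ (W k).1) :=
      fun k => hg2 (n+k) (W k).1 (W k).2
    have hW' : ∀ j k, ∀ x ∈ A (n+k), (x ∈ (W (k+j)).1 ↔ x ∈ (W k).1) := by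
      intro j k x hx
      induction j with
      | zero => rfl
      | succ j ih => exact (hW (k+j) x (hA (by omega) hx)).trans ih
    let V : Set X := {x | ∃ k, x ∈ A (n+k) ∧ x ∈ (W k).1}
    have hV : ∀ k, ∀ x ∈ A (n+k), (x ∈ V ↔ x ∈ (W k).1) := by
      intro k x hx
      refine ⟨?_, fun h => ⟨k, hx, h⟩⟩
      rintro ⟨j, hj, hjW⟩
      rcases le_total j k with h | h
      · obtain ⟨i, rfl⟩ := Nat.exists_eq_add_of_le h
        exact (hW' i j x hj).2 hjW
      · obtain ⟨i, rfl⟩ := Nat.exists_eq_add_of_le h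
        exact (hW' i k x hx).1 hjW
    have hVo : ∀ k, IsOpen[t (n+k)] ((Subtype.val : A (n+k) → X) ⁻¹' V) := by
      intro k
      have : (Subtype.val : A (n+k) → X) ⁻¹' V = Subtype.val ⁻¹' (W k).1 := by
        ext x; exact hV k x x.2
      rw [this]; exact (W k).2
    refine ⟨V, ?_, ?_⟩
    · rw [isOpen_iSup_iff]
      intro m
      rw [isOpen_coinduced]
      apply down' V n m
      rw [Nat.add_comm m n]
      exact hVo m
    · ext x
      refine (hV 0 x x.2).trans ?_
      change x.1 ∈ Subtype.val '' U ↔ _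
      exact Subtype.val_injective.mem_set_image
end
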